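/- Let ε > 0 and λ > λ₀. Then there exists a 2π-periodic solution u₁ of (∗) on ℝ such that u₁'(0) = 0, u₁'(t) > 0 for t ∈ (0, π), u₁(t) < −√(λ/3) for all t, and U̲(0) < u₁(t) < U̲(π) for t ∈ [0, π]. Moreover the function u₅ defined by u₅(t) := −u₁(t + π) is also a 2π-periodic solution of (∗), and every solution v of (∗) that is defined and bounded on all of ℝ satisfies u₁(t) ≤ v(t) ≤ u₅(t) for all t ∈ ℝ. -/

import Mathlib

open Real Set

/-- `u` is a solution of the forced Duffing equation
`ε²·u'' = u³ − λ·u + cos t` on all of `ℝ`. -/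
def IsDuffingSol (ε lam : ℝ) (u : ℝ → ℝ) : Prop :=
  ContDiff ℝ 2 u ∧
  ∀ t : ℝ, ε ^ 2 * deriv (deriv u) t = u t ^ 3 - lam * u t + Real.cos t

open Filter Topology MeasureTheory

/-- Necessary second-order condition at a local maximum. -/
theorem deriv_deriv_nonpos_of_isLocalMax {f : ℝ → ℝ} {x : ℝ} (hf : ContinuousAt f x)
    (hmax : IsLocalMax f x) : deriv (deriv f) x ≤ 0 := by
  by_contra! hpos
  have hmin : IsLocalMin f x := isLocalMin_of_deriv_deriv_pos hpos hmax.deriv_eq_zero hf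
  have hconst : f =ᶠ[𝓝 x] fun _ => f x := by
    filter_upwards [hmin, hmax] with y h₁ h₂ using le_antisymm h₂ h₁
  have hzero : deriv f =ᶠ[𝓝 x] fun _ => 0 := by simpa using hconst.deriv
  simp [hzero.deriv_eq] at hpos

theorem second_deriv_nonpos_of_isLocalMax {f f' : ℝ → ℝ} {x f'' : ℝ}
    (hf : ∀ t, HasDerivAt f (f' t) t) (hf' : HasDerivAt f' f'' x)
    (hmax : IsLocalMax f x) : f'' ≤ 0 := by
  have h := deriv_deriv_nonpos_of_isLocalMax (hf x).continuousAt hmax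
  rwa [deriv_eq hf, hf'.deriv] at h

/-- Maximum principle on the whole line: a function bounded above with `z'' ≥ c z` wherever
`z > 0` is nonpositive. -/
theorem nonpos_of_mul_le_second_deriv {z z' z'' : ℝ → ℝ} {c M : ℝ} (hc : 0 < c)
    (hz : ∀ t, HasDerivAt z (z' t) t) (hz' : ∀ t, HasDerivAt z' (z'' t) t)
    (hM : ∀ t, z t ≤ M) (h : ∀ t, 0 < z t → c * z t ≤ z'' t) (t : ℝ) : z t ≤ 0 := by
  by_contra! hpos
  obtain ⟨δ, hδ, hδc⟩ : ∃ δ, 0 < δ ∧ 2 * δ < c * z t :=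
    ⟨c * z t / 4, by positivity, by nlinarith [mul_pos hc hpos]⟩
  have hf : ∀ s, HasDerivAt (fun s => z s - δ * (s - t) ^ 2) (z' s - δ * (2 * (s - t))) s := by
    intro s
    exact ((hz s).sub ((((hasDerivAt_id s).sub_const t).pow 2).const_mul δ)).congr_deriv (by simp)
  have hf' : ∀ s, HasDerivAt (fun s => z' s - δ * (2 * (s - t))) (z'' s - δ * 2) s := by
    intro s
    exact ((hz' s).sub ((((hasDerivAt_id s).sub_const t).const_mul 2).const_mul δ)).congr_deriv
      (by simp)
  have hcont : Continuous fun s => z s - δ * (s - t) ^ 2 :=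
    continuous_iff_continuousAt.2 fun s => (hf s).continuousAt
  have hlim : ∀ᶠ s in cocompact ℝ, z s - δ * (s - t) ^ 2 ≤ z t - δ * (t - t) ^ 2 := by
    have := (tendsto_norm_cocompact_atTop (E := ℝ)).eventually_ge_atTop (|t| + 1 + M / δ)
    filter_upwards [this] with s hs
    rw [Real.norm_eq_abs] at hs
    have hM0 : 0 < M := hpos.trans_le (hM t)
    have h₁ : 1 + M / δ ≤ |s - t| := by linarith [abs_sub_abs_le_abs_sub s t]
    have h₂ : M / δ ≤ (s - t) ^ 2 := by
      rw [← sq_abs]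
      nlinarith [div_pos hM0 hδ]
    have h₃ : M ≤ δ * (s - t) ^ 2 := by
      rw [div_le_iff₀ hδ] at h₂
      linarith
    simp only [sub_self]
    linarith [hM s]
  obtain ⟨s, hs⟩ := hcont.exists_forall_ge' t hlim
  have hzs : z t ≤ z s := by
    have := hs t
    simp only [sub_self] at this
    nlinarith [mul_nonneg hδ.le (sq_nonneg (s - t))]
  have h₁ := second_deriv_nonpos_of_isLocalMax hf (hf' s) (Filter.Eventually.of_forall hs)
  have h₂ := h s (hpos.trans_le hzs)
  have h₃ := mul_le_mul_of_nonneg_left hzs hc.le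
  linarith

/-- Bounded solutions of `y' = h - k y` for bounded continuous `h`. -/
theorem exists_bounded_deriv_eq_sub_mul {h : ℝ → ℝ} {k M : ℝ} (hk : 0 < k) (hh : Continuous h)
    (hM : ∀ t, |h t| ≤ M) :
    ∃ y : ℝ → ℝ, (∀ t, HasDerivAt y (h t - k * y t) t) ∧ ∀ t, |y t| ≤ M / k := by
  have hint : ∀ t, IntegrableOn (fun s => exp (k * s) * h s) (Iic t) := fun t =>
    (integrableOn_exp_mul_Iic hk t).mul_bdd (c := M) hh.aestronglyMeasurable
      (Eventually.of_forall hM)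
  have hcont : Continuous fun s => exp (k * s) * h s := by fun_prop
  have hI : ∀ t, HasDerivAt (fun t => ∫ s in Iic t, exp (k * s) * h s) (exp (k * t) * h t) t := by
    intro t
    have h₁ := (intervalIntegral.integral_hasDerivAt_right (hcont.intervalIntegrable 0 t)
      (hcont.stronglyMeasurableAtFilter _ _) hcont.continuousAt).add_const
      (∫ s in Iic 0, exp (k * s) * h s)
    refine h₁.congr_of_eventuallyEq (Eventually.of_forall fun r => ?_)
    simp only
    rw [← intervalIntegral.integral_Iic_sub_Iic (hint 0) (hint r)]
    ring
  refine ⟨fun t => exp (-(k * t)) * ∫ s in Iic t, exp (k * s) * h s, fun t => ?_, fun t => ?_⟩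
  · have h₁ : HasDerivAt (fun t => exp (-(k * t))) (exp (-(k * t)) * (-(k * 1))) t :=
      (((hasDerivAt_id t).const_mul k).neg).exp
    refine (h₁.mul (hI t)).congr_deriv ?_
    have h₂ : exp (-(k * t)) * exp (k * t) = 1 := by rw [← exp_add]; simp
    linear_combination h t * h₂
  · have h₁ : |∫ s in Iic t, exp (k * s) * h s| ≤ ∫ s in Iic t, exp (k * s) * M := by
      refine (abs_integral_le_integral_abs).trans
        (integral_mono (hint t).abs ((integrableOn_exp_mul_Iic hk t).mul_const M) fun s => ?_)
      simp only [abs_mul, abs_exp]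
      exact mul_le_mul_of_nonneg_left (hM s) (exp_pos _).le
    rw [integral_mul_const, integral_exp_mul_Iic hk] at h₁
    rw [abs_mul, abs_exp]
    refine (mul_le_mul_of_nonneg_left h₁ (exp_pos _).le).trans (le_of_eq ?_)
    have h₂ : exp (-(k * t)) * exp (k * t) = 1 := by rw [← exp_add]; simp
    linear_combination (M / k) * h₂

/-- Bounded solutions of `y'' = k² (y - h)` for bounded continuous `h`. -/
theorem exists_bounded_second_deriv_eq {h : ℝ → ℝ} {k M : ℝ} (hk : 0 < k) (hh : Continuous h)
    (hM : ∀ t, |h t| ≤ M) :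
    ∃ y y' : ℝ → ℝ, (∀ t, HasDerivAt y (y' t) t) ∧
      (∀ t, HasDerivAt y' (k ^ 2 * (y t - h t)) t) ∧ ∃ C, ∀ t, |y t| ≤ C := by
  obtain ⟨p, hp, hpM⟩ := exists_bounded_deriv_eq_sub_mul hk hh hM
  obtain ⟨q, hq, hqM⟩ := exists_bounded_deriv_eq_sub_mul (h := fun t => h (-t)) hk
    (hh.comp continuous_neg) fun t => hM (-t)
  have hq' : ∀ t, HasDerivAt (fun t => q (-t)) (k * q (-t) - h t) t := by
    intro t
    refine ((hq (-t)).comp t (hasDerivAt_neg t)).congr_deriv ?_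
    simp only [neg_neg]
    ring
  refine ⟨fun t => k / 2 * (p t + q (-t)), fun t => k ^ 2 / 2 * (q (-t) - p t), fun t => ?_,
    fun t => ?_, k / 2 * (M / k + M / k), fun t => ?_⟩
  · exact (((hp t).add (hq' t)).const_mul (k / 2)).congr_deriv (by ring)
  · exact (((hq' t).sub (hp t)).const_mul (k ^ 2 / 2)).congr_deriv (by ring)
  · rw [abs_mul, abs_of_pos (half_pos hk)]
    exact mul_le_mul_of_nonneg_left ((abs_add_le _ _).trans (add_le_add (hpM t) (hqM (-t))))
      (half_pos hk).le

/-- Solutions of `y'' = k² (y - h)` are bounded above by any upper bound of `h`. -/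
theorem le_of_second_deriv_eq {h y y' : ℝ → ℝ} {k M C : ℝ} (hk : 0 < k)
    (hy : ∀ t, HasDerivAt y (y' t) t) (hy' : ∀ t, HasDerivAt y' (k ^ 2 * (y t - h t)) t)
    (hC : ∀ t, |y t| ≤ C) (hM : ∀ t, h t ≤ M) (t : ℝ) : y t ≤ M := by
  have := nonpos_of_mul_le_second_deriv (z := fun t => y t - M) (c := k ^ 2) (M := C - M)
    (by positivity) (fun t => (hy t).sub_const M) hy'
    (fun t => by linarith [le_of_abs_le (hC t)])
    (fun t _ => mul_le_mul_of_nonneg_left (by linarith [hM t]) (by positivity)) t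
  linarith

/-- If `F` is bounded and contracting in the state variable, then `y'' = k² (y - F y t)` has a
bounded solution. -/
theorem exists_bounded_solution_of_contracting {F : ℝ → ℝ → ℝ} {k M : ℝ} {q : NNReal}
    (hk : 0 < k) (hq : q < 1) (hF : Continuous fun p : ℝ × ℝ => F p.1 p.2)
    (hM : ∀ x t, |F x t| ≤ M) (hL : ∀ x y t, F x t - F y t ≤ q * |x - y|) :
    ∃ y y' : ℝ → ℝ, (∀ t, HasDerivAt y (y' t) t) ∧
      (∀ t, HasDerivAt y' (k ^ 2 * (y t - F (y t) t)) t) ∧ ∃ C, ∀ t, |y t| ≤ C := by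
  have hsol : ∀ v : BoundedContinuousFunction ℝ ℝ, ∃ y : BoundedContinuousFunction ℝ ℝ,
      ∃ y' : ℝ → ℝ, (∀ t, HasDerivAt y (y' t) t) ∧
        ∀ t, HasDerivAt y' (k ^ 2 * (y t - F (v t) t)) t := by
    intro v
    obtain ⟨y, y', hy, hy', C, hC⟩ := exists_bounded_second_deriv_eq (h := fun t => F (v t) t) hk
      (hF.comp (v.continuous.prodMk continuous_id)) fun t => hM _ t
    exact ⟨BoundedContinuousFunction.ofNormedAddCommGroup y
      (continuous_iff_continuousAt.2 fun s => (hy s).continuousAt) C hC, y', hy, hy'⟩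
  choose T T' hT hT' using hsol
  have hle : ∀ v w t, T v t - T w t ≤ q * dist v w := by
    intro v w t
    refine le_of_second_deriv_eq (y := fun t => T v t - T w t)
      (h := fun t => F (v t) t - F (w t) t) (C := ‖T v‖ + ‖T w‖) hk
      (fun t => (hT v t).sub (hT w t)) (fun t => ?_) (fun t => ?_) (fun t => ?_) t
    · exact ((hT' v t).sub (hT' w t)).congr_deriv (by ring)
    · exact (abs_sub _ _).trans (add_le_add ((T v).norm_coe_le_norm t) ((T w).norm_coe_le_norm t))
    · exact (hL _ _ t).trans
        (mul_le_mul_of_nonneg_left (by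
          rw [← Real.dist_eq]
          exact BoundedContinuousFunction.dist_coe_le_dist t) q.2)
  have hT_contr : ContractingWith q T := by
    refine ⟨hq, LipschitzWith.of_dist_le_mul fun v w => ?_⟩
    refine (BoundedContinuousFunction.dist_le (by positivity)).2 fun t => ?_
    rw [Real.dist_eq, abs_le]
    have h₁ := hle v w t
    have h₂ := hle w v t
    rw [dist_comm w v] at h₂
    constructor <;> linarith
  have hfix : T hT_contr.fixedPoint = hT_contr.fixedPoint := hT_contr.fixedPoint_isFixedPt
  set y := hT_contr.fixedPoint
  refine ⟨y, T' y, fun t => ?_, fun t => ?_, ‖y‖, fun t => y.norm_coe_le_norm t⟩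
  · have := hT y t
    rwa [hfix] at this
  · have := hT' y t
    rwa [hfix] at this

/-- A bounded function with `p'' ≤ c p - d (1 - σ cos t)`, `σ² = 1`, is positive. -/
theorem pos_of_second_deriv_le {p p' p'' : ℝ → ℝ} {c d σ C : ℝ} (hc : 0 < c) (hd : 0 < d)
    (hσ : σ ^ 2 = 1) (hp : ∀ t, HasDerivAt p (p' t) t) (hp' : ∀ t, HasDerivAt p' (p'' t) t)
    (hC : ∀ t, |p t| ≤ C) (h : ∀ t, p'' t ≤ c * p t - d * (1 - σ * cos t)) (t : ℝ) :
    0 < p t := by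
  have hq : ∀ t, |σ * cos t| ≤ 1 := fun t => by
    rw [← sq_le_one_iff_abs_le_one, mul_pow, hσ, one_mul]
    exact cos_sq_le_one t
  obtain ⟨δ, hδ, hδc⟩ : ∃ δ, 0 < δ ∧ δ * (1 + c) = d :=
    ⟨d / (1 + c), by positivity, by field_simp⟩
  have hcc : c * c⁻¹ = 1 := mul_inv_cancel₀ hc.ne'
  have hc' : 0 < c⁻¹ := inv_pos.2 hc
  have key := nonpos_of_mul_le_second_deriv
    (z := fun t => δ * (c⁻¹ + 1 - σ * cos t) - p t)
    (z' := fun t => δ * (σ * sin t) - p' t)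
    (z'' := fun t => δ * (σ * cos t) - p'' t) (c := c) (M := δ * (c⁻¹ + 2) + C) hc
    (fun t => ((((hasDerivAt_cos t).const_mul σ).const_sub _).const_mul δ |>.sub
      (hp t)).congr_deriv (by ring))
    (fun t => (((hasDerivAt_sin t).const_mul σ).const_mul δ).sub (hp' t))
    (fun t => by
      have h₁ : δ * (c⁻¹ + 1 - σ * cos t) ≤ δ * (c⁻¹ + 2) :=
        mul_le_mul_of_nonneg_left (by linarith [neg_le_of_abs_le (hq t)]) hδ.le
      linarith [neg_le_of_abs_le (hC t)])
    (fun t _ => by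
      have h₁ : c * (δ * (c⁻¹ + 1 - σ * cos t)) - d * (1 - σ * cos t) = δ * (σ * cos t) := by
        linear_combination δ * hcc + (1 - σ * cos t) * hδc
      linarith [h t]) t
  have h₁ : 0 < δ * (c⁻¹ + 1 - σ * cos t) :=
    mul_pos hδ (by linarith [le_of_abs_le (hq t)])
  linarith

section Duffing

variable {ε lam : ℝ} {u v : ℝ → ℝ}

theorem IsDuffingSol.hasDerivAt (hu : IsDuffingSol ε lam u) (t : ℝ) :
    HasDerivAt u (deriv u t) t :=
  (hu.1.differentiable (by norm_num) t).hasDerivAt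

theorem IsDuffingSol.hasDerivAt_deriv (hε : 0 < ε) (hu : IsDuffingSol ε lam u) (t : ℝ) :
    HasDerivAt (deriv u) ((u t ^ 3 - lam * u t + cos t) / ε ^ 2) t := by
  have h₁ : Differentiable ℝ (deriv u) :=
    ((contDiff_succ_iff_deriv (n := 1)).1 hu.1).2.2.differentiable (by norm_num)
  rw [← hu.2 t, mul_div_cancel_left₀ _ (by positivity)]
  exact (h₁ t).hasDerivAt

theorem isDuffingSol_of_hasDerivAt {u' : ℝ → ℝ} (hε : 0 < ε) (hu : ∀ t, HasDerivAt u (u' t) t)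
    (hu' : ∀ t, HasDerivAt u' ((u t ^ 3 - lam * u t + cos t) / ε ^ 2) t) :
    IsDuffingSol ε lam u := by
  have hcont : Continuous u := continuous_iff_continuousAt.2 fun t => (hu t).continuousAt
  refine ⟨(contDiff_succ_iff_deriv (n := 1)).2 ⟨fun t => (hu t).differentiableAt, by simp, ?_⟩,
    fun t => ?_⟩
  · rw [deriv_eq hu, contDiff_one_iff_deriv, deriv_eq hu']
    exact ⟨fun t => (hu' t).differentiableAt, by fun_prop⟩
  · rw [deriv_eq hu, (hu' t).deriv, mul_div_cancel₀ _ (by positivity)]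

theorem IsDuffingSol.comp_neg (hε : 0 < ε) (hu : IsDuffingSol ε lam u) :
    IsDuffingSol ε lam fun t => u (-t) := by
  refine isDuffingSol_of_hasDerivAt (u' := fun t => -deriv u (-t)) hε (fun t => ?_) fun t => ?_
  · exact ((hu.hasDerivAt (-t)).comp t (hasDerivAt_neg t)).congr_deriv (by ring)
  · exact ((hu.hasDerivAt_deriv hε (-t)).comp t (hasDerivAt_neg t)).neg.congr_deriv
      (by rw [cos_neg]; ring)

theorem IsDuffingSol.comp_add_const (hε : 0 < ε) (hu : IsDuffingSol ε lam u) {τ : ℝ}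
    (hτ : ∀ t, cos (t + τ) = cos t) : IsDuffingSol ε lam fun t => u (t + τ) := by
  refine isDuffingSol_of_hasDerivAt (u' := fun t => deriv u (t + τ)) hε
    (fun t => (hu.hasDerivAt (t + τ)).comp_add_const t τ) fun t => ?_
  have := (hu.hasDerivAt_deriv hε (t + τ)).comp_add_const t τ
  rwa [hτ] at this

theorem IsDuffingSol.neg_comp_add_pi (hε : 0 < ε) (hu : IsDuffingSol ε lam u) :
    IsDuffingSol ε lam fun t => -u (t + π) := by
  refine isDuffingSol_of_hasDerivAt (u' := fun t => -deriv u (t + π)) hε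
    (fun t => ((hu.hasDerivAt (t + π)).comp_add_const t π).neg) fun t => ?_
  exact ((hu.hasDerivAt_deriv hε (t + π)).comp_add_const t π).neg.congr_deriv
    (by rw [cos_add_pi]; ring)

/-- A solution staying in the region where the cubic is increasing with positive slope lies below
every bounded solution. -/
theorem IsDuffingSol.le_of_bounded {b M : ℝ} (hε : 0 < ε) (hu : IsDuffingSol ε lam u)
    (hv : IsDuffingSol ε lam v) (hb : b < 0) (hlam : lam < 3 * b ^ 2) (hub : ∀ t, u t ≤ b)
    (hM : ∀ t, |v t| ≤ M) (t : ℝ) : u t ≤ v t := by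
  have key := nonpos_of_mul_le_second_deriv (z := fun t => u t - v t)
    (c := (3 * b ^ 2 - lam) / ε ^ 2) (M := b + M)
    (div_pos (by linarith) (by positivity)) (fun t => (hu.hasDerivAt t).sub (hv.hasDerivAt t))
    (fun t => (hu.hasDerivAt_deriv hε t).sub (hv.hasDerivAt_deriv hε t))
    (fun t => by linarith [hub t, neg_le_of_abs_le (hM t)])
    (fun t ht => ?_) t
  · linarith
  · have h₁ : 3 * b ^ 2 ≤ u t ^ 2 + u t * v t + v t ^ 2 := by
      nlinarith [hub t, mul_nonneg (sub_nonneg.2 (hub t)) (sub_nonneg.2 (hub t)),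
        mul_nonneg (sub_nonneg.2 (hub t)) ht.le]
    rw [← sub_div, div_mul_eq_mul_div]
    gcongr
    nlinarith [mul_le_mul_of_nonneg_right h₁ ht.le]

/-- A bounded solution with values in `[a, b]`, where `a` and `b` are zeros of the cubic at
`t = 0` and `t = π`. -/
theorem exists_isDuffingSol_mem_Icc {a b : ℝ} (hε : 0 < ε) (hlam : 0 < lam) (hab : a < b)
    (hb : b < 0) (hlamb : lam < 3 * b ^ 2) (ha : a ^ 3 - lam * a = -1)
    (hb' : b ^ 3 - lam * b = 1) :
    ∃ u, IsDuffingSol ε lam u ∧ ∀ t, u t ∈ Icc a b := by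
  have ha0 : a < 0 := hab.trans hb
  have ha_ne : a ≠ 0 := ha0.ne
  set K : ℝ := 3 * a ^ 2 with hK
  have hK0 : 0 < K := by positivity
  have hcK : 3 * b ^ 2 - lam < K := by nlinarith
  set φ : ℝ → ℝ := fun x => max a (min b x) with hφ
  have hφa : ∀ x, a ≤ φ x := fun x => le_max_left _ _
  have hφb : ∀ x, φ x ≤ b := fun x => max_le hab.le (min_le_left _ _)
  have hφc : Continuous φ := by fun_prop
  have hφL : ∀ x y, |φ x - φ y| ≤ |x - y| := fun x y =>
    calc |φ x - φ y| ≤ max |a - a| |min b x - min b y| := abs_max_sub_max_le_max _ _ _ _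
      _ ≤ max |a - a| (max |b - b| |x - y|) :=
        max_le_max le_rfl (abs_min_sub_min_le_max _ _ _ _)
      _ = |x - y| := by simp
  set F : ℝ → ℝ → ℝ := fun x t => φ x - (φ x ^ 3 - lam * φ x + cos t) / K with hF
  have hdiff : ∀ x y t, K * (F x t - F y t) =
      (φ x - φ y) * (K - (φ x ^ 2 + φ x * φ y + φ y ^ 2 - lam)) := by
    intro x y t
    simp only [hF]
    field_simp
    ring
  have hfac : ∀ x y, 0 ≤ K - (φ x ^ 2 + φ x * φ y + φ y ^ 2 - lam) ∧
      K - (φ x ^ 2 + φ x * φ y + φ y ^ 2 - lam) ≤ K - (3 * b ^ 2 - lam) := by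
    intro x y
    have h₁ := hφa x
    have h₂ := hφa y
    have h₃ := hφb x
    have h₄ := hφb y
    constructor <;> nlinarith
  have hFb : ∀ x t, F x t ≤ b := by
    intro x t
    have h₁ : 0 ≤ (b - φ x) * (K - (φ b ^ 2 + φ b * φ x + φ x ^ 2 - lam)) :=
      mul_nonneg (sub_nonneg.2 (hφb x)) (hfac b x).1
    have h₂ : φ b = b := by simp [hφ, hab.le]
    rw [h₂] at h₁
    simp only [hF]
    rw [sub_le_iff_le_add, ← sub_le_iff_le_add', le_div_iff₀ hK0]
    nlinarith [neg_one_le_cos t]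
  have hFa : ∀ x t, a ≤ F x t := by
    intro x t
    have h₁ : 0 ≤ (φ x - a) * (K - (φ x ^ 2 + φ x * φ a + φ a ^ 2 - lam)) :=
      mul_nonneg (sub_nonneg.2 (hφa x)) (hfac x a).1
    have h₂ : φ a = a := by simp [hφ, hab.le]
    rw [h₂] at h₁
    simp only [hF]
    rw [le_sub_comm, div_le_iff₀ hK0]
    nlinarith [cos_le_one t]
  obtain ⟨k, hk, hkK⟩ : ∃ k : ℝ, 0 < k ∧ k ^ 2 = K / ε ^ 2 :=
    ⟨√(K / ε ^ 2), by positivity, Real.sq_sqrt (by positivity)⟩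
  obtain ⟨q, hq⟩ : ∃ q : NNReal, (q : ℝ) = (K - (3 * b ^ 2 - lam)) / K :=
    ⟨⟨_, div_nonneg (by linarith) hK0.le⟩, rfl⟩
  obtain ⟨u, u', hu, hu', C, hC⟩ := exists_bounded_solution_of_contracting (F := F) (M := -a) (q := q) hk
    (by
      rw [← NNReal.coe_lt_coe, hq, NNReal.coe_one, div_lt_one hK0]
      linarith)
    (by simp only [hF]; fun_prop)
    (fun x t => abs_le.2 ⟨by linarith [hFa x t], by linarith [hFb x t]⟩)
    (fun x y t => by
      rw [hq, div_mul_eq_mul_div, le_div_iff₀ hK0, mul_comm, hdiff]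
      calc _ ≤ |φ x - φ y| * (K - (φ x ^ 2 + φ x * φ y + φ y ^ 2 - lam)) :=
            mul_le_mul_of_nonneg_right (le_abs_self _) (hfac x y).1
        _ ≤ |x - y| * (K - (3 * b ^ 2 - lam)) :=
            mul_le_mul (hφL x y) (hfac x y).2 (hfac x y).1 (abs_nonneg _)
        _ = _ := mul_comm _ _)
  have hub : ∀ t, u t ≤ b := le_of_second_deriv_eq hk hu hu' hC fun t => hFb _ t
  have hua : ∀ t, a ≤ u t := fun t => by
    have := le_of_second_deriv_eq (y := fun t => -u t) (h := fun t => -F (u t) t) (M := -a) hk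
      (fun t => (hu t).neg) (fun t => (hu' t).neg.congr_deriv (by ring))
      (fun t => by rw [abs_neg]; exact hC t) (fun t => neg_le_neg (hFa _ t)) t
    linarith
  refine ⟨u, isDuffingSol_of_hasDerivAt hε hu fun t => ?_, fun t => ⟨hua t, hub t⟩⟩
  refine (hu' t).congr_deriv ?_
  have h₁ : φ (u t) = u t := by simp [hφ, hua t, hub t]
  simp only [hF, h₁, hkK]
  field_simp
  ring

/-- Solutions in `[a, b]` as above lie strictly between `a` and `b`. -/
theorem IsDuffingSol.mem_Ioo {a b : ℝ} (hε : 0 < ε) (hlam : 0 < lam) (hu : IsDuffingSol ε lam u)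
    (hb : b < 0) (ha : a ^ 3 - lam * a = -1) (hb' : b ^ 3 - lam * b = 1)
    (hab : ∀ t, u t ∈ Icc a b) (t : ℝ) : u t ∈ Ioo a b := by
  have ha0 : a < 0 := ((hab 0).1.trans (hab 0).2).trans_lt hb
  have ha_ne : a ≠ 0 := ha0.ne
  have hbd : ∀ t, |u t| ≤ -a := fun t =>
    abs_le.2 ⟨by linarith [(hab t).1], by linarith [(hab t).2]⟩
  have hc : 0 < 3 * a ^ 2 / ε ^ 2 := by positivity
  have hd : 0 < 1 / ε ^ 2 := by positivity
  constructor
  · have := pos_of_second_deriv_le (p := fun t => u t - a) (σ := 1) (C := -a + -a) hc hd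
      (by norm_num) (fun t => (hu.hasDerivAt t).sub_const a) (hu.hasDerivAt_deriv hε)
      (fun t => (abs_sub _ _).trans (add_le_add (hbd t) (abs_of_neg ha0).le)) (fun t => ?_) t
    · linarith
    · rw [div_mul_eq_mul_div, div_mul_eq_mul_div, ← sub_div]
      gcongr
      have h₁ := hab t
      have h₂ : u t ^ 2 + u t * a + a ^ 2 - lam ≤ 3 * a ^ 2 := by nlinarith [h₁.1, h₁.2]
      nlinarith [mul_le_mul_of_nonneg_left h₂ (sub_nonneg.2 h₁.1)]
  · have := pos_of_second_deriv_le (p := fun t => b - u t) (σ := -1) (C := -b + -a) hc hd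
      (by norm_num) (fun t => (hu.hasDerivAt t).const_sub b)
      (fun t => (hu.hasDerivAt_deriv hε t).neg)
      (fun t => (abs_sub _ _).trans (add_le_add (abs_of_neg hb).le (hbd t))) (fun t => ?_) t
    · linarith
    · rw [div_mul_eq_mul_div, div_mul_eq_mul_div, ← sub_div, ← neg_div]
      gcongr
      have h₁ := hab t
      have h₂ : b ^ 2 + b * u t + u t ^ 2 - lam ≤ 3 * a ^ 2 := by nlinarith [h₁.1, h₁.2]
      nlinarith [mul_le_mul_of_nonneg_left h₂ (sub_nonneg.2 h₁.2)]

/-- Solutions critical at `0` and `π` with `3u² > λ` are strictly increasing on `[0, π]`. -/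
theorem IsDuffingSol.deriv_pos (hε : 0 < ε) (hu : IsDuffingSol ε lam u)
    (h : ∀ t, lam < 3 * u t ^ 2) (h₀ : deriv u 0 = 0) (hπ : deriv u π = 0) {t : ℝ}
    (ht : t ∈ Ioo 0 π) : 0 < deriv u t := by
  by_contra! hneg
  have hcont : Continuous (deriv u) :=
    continuous_iff_continuousAt.2 fun s => (hu.hasDerivAt_deriv hε s).continuousAt
  obtain ⟨s, hs, hs', hmin⟩ : ∃ s ∈ Ioo 0 π, deriv u s ≤ 0 ∧ IsLocalMin (deriv u) s := by
    obtain ⟨s, hs, hmin⟩ := isCompact_Icc.exists_isMinOn ⟨t, Ioo_subset_Icc_self ht⟩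
      hcont.continuousOn
    by_cases hmem : s ∈ Ioo 0 π
    · exact ⟨s, hmem, (hmin (Ioo_subset_Icc_self ht)).trans hneg,
        hmin.isLocalMin (Icc_mem_nhds hmem.1 hmem.2)⟩
    · have hs0 : deriv u s = 0 := by
        rcases hs.1.eq_or_lt with rfl | h₁
        · exact h₀
        · rcases hs.2.eq_or_lt with rfl | h₂
          · exact hπ
          · exact absurd ⟨h₁, h₂⟩ hmem
      refine ⟨t, ht, hneg, IsMinOn.isLocalMin (s := Icc 0 π) (fun r hr => ?_)
        (Icc_mem_nhds ht.1 ht.2)⟩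
      exact hneg.trans (hs0.symm.le.trans (hmin hr))
  have hder : HasDerivAt (fun t => (u t ^ 3 - lam * u t + cos t) / ε ^ 2)
      (((3 * u s ^ 2 - lam) * deriv u s - sin s) / ε ^ 2) s := by
    have h₁ := hu.hasDerivAt s
    exact ((((h₁.pow 3).sub (h₁.const_mul lam)).add (hasDerivAt_cos s)).div_const _).congr_deriv
      (by push_cast; ring)
  have h₁ := second_deriv_nonpos_of_isLocalMax (fun t => (hu.hasDerivAt_deriv hε t).neg) hder.neg
    hmin.neg
  have h₂ : ((3 * u s ^ 2 - lam) * deriv u s - sin s) / ε ^ 2 < 0 :=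
    div_neg_of_neg_of_pos
      (by nlinarith [h s, sin_pos_of_pos_of_lt_pi hs.1 hs.2]) (by positivity)
  linarith

end Duffing

theorem half_lt_sqrt_pow_three {lam : ℝ} (hlam : (3 : ℝ) / (2 : ℝ) ^ ((2 : ℝ) / 3) < lam) :
    1 / 2 < √(lam / 3) ^ 3 := by
  have h₁ : (0 : ℝ) < 1 / (2 : ℝ) ^ ((2 : ℝ) / 3) := by positivity
  have h₂ : 1 / (2 : ℝ) ^ ((2 : ℝ) / 3) < lam / 3 := by
    rw [lt_div_iff₀ (by norm_num)]
    linarith [div_eq_mul_one_div (3 : ℝ) ((2 : ℝ) ^ ((2 : ℝ) / 3))]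
  have h₃ : (1 / (2 : ℝ) ^ ((2 : ℝ) / 3)) ^ 3 = 1 / 4 := by
    rw [div_pow, ← Real.rpow_natCast (_ ^ _), ← Real.rpow_mul (by norm_num)]
    norm_num
  have h₄ : (1 / 2 : ℝ) ^ 2 < (√(lam / 3) ^ 3) ^ 2 := by
    calc (1 / 2 : ℝ) ^ 2 = (1 / (2 : ℝ) ^ ((2 : ℝ) / 3)) ^ 3 := by rw [h₃]; norm_num
      _ < (lam / 3) ^ 3 := pow_lt_pow_left₀ h₂ h₁.le (by norm_num)
      _ = (√(lam / 3) ^ 2) ^ 3 := by rw [Real.sq_sqrt (h₁.trans h₂).le]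
      _ = _ := by ring
  exact lt_of_pow_lt_pow_left₀ 2 (by positivity) h₄

/-- The cubic `x³ - λ x` attains `-1` and `1` on its left increasing branch. -/
theorem exists_cubic_eq_neg_one_and_one {lam s : ℝ} (hs : 0 < s) (hs3 : 1 / 2 < s ^ 3)
    (hlam : lam = 3 * s ^ 2) :
    ∃ a b : ℝ, a < b ∧ b < -s ∧ a ^ 3 - lam * a = -1 ∧ b ^ 3 - lam * b = 1 := by
  subst hlam
  have hg : Continuous fun x : ℝ => x ^ 3 - 3 * s ^ 2 * x := by fun_prop
  have hL : (-(2 * s + 2)) ^ 3 - 3 * s ^ 2 * (-(2 * s + 2)) ≤ -1 := by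
    have h₁ : 0 < s ^ 2 := by positivity
    nlinarith [mul_pos h₁ hs]
  obtain ⟨b, hb, hb'⟩ := intermediate_value_Icc (show -(2 * s + 2) ≤ -s by linarith)
    hg.continuousOn (show (1 : ℝ) ∈ _ from ⟨by linarith, by nlinarith⟩)
  obtain ⟨a, ha, ha'⟩ := intermediate_value_Icc hb.1 hg.continuousOn
    (show (-1 : ℝ) ∈ _ from ⟨hL, by simp only at hb' ⊢; rw [hb']; norm_num⟩)
  refine ⟨a, b, lt_of_le_of_ne ha.2 ?_, lt_of_le_of_ne hb.2 ?_, ha', hb'⟩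
  · rintro rfl
    simp only at ha' hb'
    linarith
  · rintro rfl
    simp only at hb'
    nlinarith

/-- For `ε > 0` and `λ > λ₀ = 3/2^(2/3)` there is a `2π`-periodic solution `u₁`
of the Duffing equation with `u₁'(0) = 0`, `u₁' > 0` on `(0,π)`,
`u₁ < −√(λ/3)` everywhere and `U̲(0) < u₁ < U̲(π)` on `[0,π]`; moreover
`u₅(t) := −u₁(t+π)` is also a `2π`-periodic solution, and every solution
bounded on all of `ℝ` lies between `u₁` and `u₅`. -/
theorem stmt_3 (ε lam : ℝ) (hε : 0 < ε)
    (hlam : (3 : ℝ) / (2 : ℝ) ^ ((2 : ℝ) / 3) < lam) :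
    ∃ u₁ : ℝ → ℝ, IsDuffingSol ε lam u₁ ∧
      Function.Periodic u₁ (2 * π) ∧
      deriv u₁ 0 = 0 ∧
      (∀ t ∈ Ioo (0 : ℝ) π, 0 < deriv u₁ t) ∧
      (∀ t : ℝ, u₁ t < -Real.sqrt (lam / 3)) ∧
      (∀ a b : ℝ,
        (a ^ 3 - lam * a + Real.cos 0 = 0 ∧
          ∀ y : ℝ, y ^ 3 - lam * y + Real.cos 0 = 0 → a ≤ y) →
        (b ^ 3 - lam * b + Real.cos π = 0 ∧
          ∀ y : ℝ, y ^ 3 - lam * y + Real.cos π = 0 → b ≤ y) →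
        ∀ t ∈ Icc (0 : ℝ) π, a < u₁ t ∧ u₁ t < b) ∧
      (∀ u₅ : ℝ → ℝ, u₅ = (fun t => -u₁ (t + π)) →
        IsDuffingSol ε lam u₅ ∧ Function.Periodic u₅ (2 * π) ∧
        ∀ v : ℝ → ℝ, IsDuffingSol ε lam v → (∃ M : ℝ, ∀ t : ℝ, |v t| ≤ M) →
          ∀ t : ℝ, u₁ t ≤ v t ∧ v t ≤ u₅ t) := by
  have hs3 := half_lt_sqrt_pow_three hlam
  have hlam0 : 0 < lam := lt_trans (by positivity) hlam
  have hs : 0 < √(lam / 3) := by positivity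
  have hs2 : lam = 3 * √(lam / 3) ^ 2 := by
    rw [Real.sq_sqrt (by positivity)]
    ring
  obtain ⟨a, b, hab, hbs, ha, hb⟩ := exists_cubic_eq_neg_one_and_one hs hs3 hs2
  have hb0 : b < 0 := by linarith
  have hlamb : lam < 3 * b ^ 2 := by nlinarith
  obtain ⟨u, hu, huab⟩ := exists_isDuffingSol_mem_Icc hε hlam0 hab hb0 hlamb ha hb
  have hmem := hu.mem_Ioo hε hlam0 hb0 ha hb huab
  have hleast : ∀ v, IsDuffingSol ε lam v → (∃ M : ℝ, ∀ t : ℝ, |v t| ≤ M) → ∀ t, u t ≤ v t :=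
    fun v hv ⟨M, hM⟩ => hu.le_of_bounded hε hv hb0 hlamb (fun t => (huab t).2) hM
  have hbd : ∀ t, |u t| ≤ -a := fun t =>
    abs_le.2 ⟨by linarith [(huab t).1], by linarith [(huab t).2]⟩
  have heven : ∀ t, u (-t) = u t := fun t => by
    have h₁ := hleast _ (hu.comp_neg hε) ⟨-a, fun t => hbd _⟩
    have h₂ := h₁ (-t)
    rw [neg_neg] at h₂
    exact le_antisymm h₂ (h₁ t)
  have hper : Function.Periodic u (2 * π) := fun t => by
    have h₁ := hleast _ (hu.comp_add_const hε cos_add_two_pi) ⟨-a, fun t => hbd _⟩ t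
    have h₂ := hleast _ (hu.comp_add_const (τ := -(2 * π)) hε fun t => by
      rw [← sub_eq_add_neg, cos_sub_two_pi]) ⟨-a, fun t => hbd _⟩ (t + 2 * π)
    rw [add_neg_cancel_right] at h₂
    exact le_antisymm h₂ h₁
  have hodd : ∀ t, deriv u (-t) = -deriv u t := fun t => by
    have h₁ := deriv_comp_neg u t
    simp only [heven] at h₁
    linarith
  have h₀ : deriv u 0 = 0 := by
    have := hodd 0
    rw [neg_zero] at this
    linarith
  have hπ : deriv u π = 0 := by
    have h₁ := hodd π
    have h₂ := deriv_comp_add_const u (2 * π) (-π)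
    rw [show (fun x => u (x + 2 * π)) = u from funext hper,
      show -π + 2 * π = π by ring] at h₂
    linarith
  have hlamu : ∀ t, lam < 3 * u t ^ 2 := fun t => by nlinarith [(huab t).2]
  refine ⟨u, hu, hper, h₀, fun t ht => hu.deriv_pos hε hlamu h₀ hπ ht,
    fun t => (huab t).2.trans_lt hbs, ?_, ?_⟩
  · rintro a' b' ⟨ha', hamin⟩ ⟨hb', hbmin⟩ t -
    rw [cos_zero] at hamin
    rw [cos_pi] at hb' hbmin
    have h₁ : b' ≤ b := hbmin b (by linarith)
    have h₂ : b' = b := by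
      have h₃ : (b - b') * (b ^ 2 + b * b' + b' ^ 2 - lam) = 0 := by linear_combination hb - hb'
      rcases mul_eq_zero.1 h₃ with h | h
      · linarith
      · nlinarith
    exact ⟨(hamin a (by linarith)).trans_lt (hmem t).1, h₂ ▸ (hmem t).2⟩
  · rintro _ rfl
    refine ⟨hu.neg_comp_add_pi hε, fun t => ?_, fun v hv ⟨M, hM⟩ t =>
      ⟨hleast v hv ⟨M, hM⟩ t, ?_⟩⟩
    · simp only
      rw [add_right_comm, hper]
    · have h₁ := hleast _ (hv.neg_comp_add_pi hε) ⟨M, fun t => by rw [abs_neg]; exact hM _⟩ (t - π)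
      have h₂ := hper (t - π)
      rw [show t - π + 2 * π = t + π by ring] at h₂
      rw [sub_add_cancel] at h₁
      simp only
      linarith
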